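/- If F is a flat R-module with a short exact sequence 0 → F → P → F → 0 (P projective), then the countable-index 'telescope' short exact sequence 0 → ⊕_{k≥0} F → ⊕_{k≥0} P → F' → 0 with F' flat shows F has projective dimension at most 1. -/

import Mathlib

namespace BG

open Finsupp

section
variable {R : Type*} [CommRing R] {X : Type*}

lemma supp_mem {M : Type*} [AddCommGroup M] [Module R M] {Y : Set X} (f : (X →₀ R) →ₗ[R] M)
    (N : Submodule R M) (h : ∀ s ∈ Y, f (single s 1) ∈ N) :
    ∀ y ∈ supported R R Y, f y ∈ N := by
  have : supported R R Y ≤ N.comap f := by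
    rw [supported_eq_span_single, Submodule.span_le]
    rintro _ ⟨s, hs, rfl⟩
    exact h s hs
  exact this

lemma supp_eq {M : Type*} [AddCommGroup M] [Module R M] {Y : Set X} (f g : (X →₀ R) →ₗ[R] M)
    (h : ∀ s ∈ Y, f (single s 1) = g (single s 1)) :
    ∀ y ∈ supported R R Y, f y = g y := by
  intro y hy
  have := supp_mem (f - g) ⊥ (by intro s hs; simp [h s hs]) y hy
  simpa [sub_eq_zero] using this

open Classical in
/-- Projection onto the span of the basis vectors in `Y`. -/
noncomputable def fl (R : Type*) [CommRing R] {X : Type*} (Y : Set X) :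
    (X →₀ R) →ₗ[R] (X →₀ R) :=
  (supported R R Y).subtype ∘ₗ restrictDom R R Y

lemma fl_mem (Y : Set X) (y : X →₀ R) : fl R Y y ∈ supported R R Y := by
  simp only [fl, LinearMap.comp_apply, Submodule.subtype_apply]
  exact Submodule.coe_mem _

lemma fl_eq {Y : Set X} {y : X →₀ R} (hy : y ∈ supported R R Y) : fl R Y y = y := by
  classical
  have := LinearMap.congr_fun (restrictDom_comp_subtype (M := R) (R := R) Y) ⟨y, hy⟩
  simp only [fl, LinearMap.comp_apply, Submodule.subtype_apply]
  have h2 := congrArg Subtype.val this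
  simpa using h2

/-- Local contractibility of `(P, d)`. -/
def Loc {P : Type*} [AddCommGroup P] [Module R P] (d : P →ₗ[R] P) : Prop :=
  ∀ A : Finset P, ∃ h : P →ₗ[R] P, ∀ y ∈ A, d (h y) + h (d y) = y

/-- `h` contracts the subcomplex spanned by `Y`. -/
def Good (d : (X →₀ R) →ₗ[R] (X →₀ R)) (Y : Set X) (h : (X →₀ R) →ₗ[R] (X →₀ R)) : Prop :=
  ∀ y ∈ supported R R Y, d y ∈ supported R R Y ∧ h y ∈ supported R R Y ∧ d (h y) + h (d y) = y

lemma good_of_basis {d : (X →₀ R) →ₗ[R] (X →₀ R)} {Y : Set X} {h : (X →₀ R) →ₗ[R] (X →₀ R)}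
    (H : ∀ s ∈ Y, d (single s 1) ∈ supported R R Y ∧ h (single s 1) ∈ supported R R Y ∧
      d (h (single s 1)) + h (d (single s 1)) = single s 1) : Good d Y h := by
  intro y hy
  exact ⟨supp_mem d _ (fun s hs => (H s hs).1) y hy, supp_mem h _ (fun s hs => (H s hs).2.1) y hy,
    supp_eq (d ∘ₗ h + h ∘ₗ d) LinearMap.id (fun s hs => (H s hs).2.2) y hy⟩

lemma exists_fin (A : Finset (X →₀ R)) : ∃ T : Finset X, ∀ y ∈ A, y ∈ supported R R (T : Set X) := by
  classical
  refine ⟨A.biUnion fun y => y.support, fun y hy => ?_⟩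
  rw [mem_supported]
  exact_mod_cast Finset.subset_biUnion_of_mem (fun y : X →₀ R => y.support) hy

lemma step {d : (X →₀ R) →ₗ[R] (X →₀ R)} (L : Loc d) (S : Finset X) :
    ∃ (h : (X →₀ R) →ₗ[R] (X →₀ R)) (S' : Finset X), S ⊆ S' ∧
      (∀ y ∈ supported R R (S : Set X), d y ∈ supported R R (S' : Set X)) ∧
      (∀ y, h y ∈ supported R R (S' : Set X)) ∧
      (∀ y, d (h y) ∈ supported R R (S' : Set X)) ∧
      (∀ y ∈ supported R R (S : Set X), d (h y) + h (d y) = y) := by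
  classical
  obtain ⟨g, hg⟩ := L (S.image fun s => single s 1)
  obtain ⟨T0, hT0⟩ := exists_fin (S.image fun s => d (single s 1))
  let T := S ∪ T0
  obtain ⟨U, hU⟩ := exists_fin ((T.image fun s => g (single s 1)) ∪
    (T.image fun s => d (g (single s 1))))
  have hdT : ∀ y ∈ supported R R (S : Set X), d y ∈ supported R R (T : Set X) := by
    apply supp_mem
    intro s hs
    exact supported_mono (by simp [T]) (hT0 _ (Finset.mem_image_of_mem _ hs))
  refine ⟨g ∘ₗ fl R (T : Set X), T ∪ U, ?_, ?_, ?_, ?_, ?_⟩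
  · intro x hx; simp [T, hx]
  · intro y hy
    exact supported_mono (by simp) (hdT y hy)
  · intro y
    refine supp_mem g _ (fun s hs => ?_) _ (fl_mem (T : Set X) y)
    exact supported_mono (by simp) (hU _ (Finset.mem_union_left _ (Finset.mem_image_of_mem _ hs)))
  · intro y
    refine supp_mem (d ∘ₗ g) _ (fun s hs => ?_) _ (fl_mem (T : Set X) y)
    exact supported_mono (by simp) (hU _ (Finset.mem_union_right _ (Finset.mem_image_of_mem _ hs)))
  · intro y hy
    have h1 : y ∈ supported R R (T : Set X) := supported_mono (by simp [T]) hy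
    simp only [LinearMap.comp_apply]
    rw [fl_eq h1, fl_eq (hdT y hy)]
    exact supp_eq (d ∘ₗ g + g ∘ₗ d) LinearMap.id
      (fun s hs => hg _ (Finset.mem_image_of_mem _ hs)) y hy

lemma seq {d : (X →₀ R) →ₗ[R] (X →₀ R)} (hd : ∀ y, d (d y) = 0) (L : Loc d) (x : X) :
    ∃ (Z : Set X) (h : (X →₀ R) →ₗ[R] (X →₀ R)), x ∈ Z ∧ Good d Z h := by
  classical
  choose g nx h1 h2 h3 h4 h5 using step L
  let S : ℕ → Finset X := fun n => nx^[n] {x}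
  have hS : ∀ n, S (n+1) = nx (S n) := fun n => Function.iterate_succ_apply' nx n _
  have mono : Monotone S := monotone_nat_of_le_succ fun n => by rw [hS]; exact h1 _
  let E : ℕ → (X →₀ R) →ₗ[R] (X →₀ R) := fun n => d ∘ₗ g (S n) + g (S n) ∘ₗ d
  have hE : ∀ n y, E n y = d (g (S n) y) + g (S n) (d y) := fun n y => rfl
  have hEm : ∀ n y, E n y ∈ supported R R (S (n+1) : Set X) := fun n y => by
    rw [hS, hE]; exact add_mem (h4 _ _) (h3 _ _)
  have hE1 : ∀ n, ∀ y ∈ supported R R (S n : Set X), E n y = y := fun n y hy => h5 _ y hy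
  have hEE : ∀ n y, E (n+1) (E n y) = E n y := fun n y => hE1 _ _ (hEm n y)
  have hEd : ∀ n y, E n (d y) = d (E n y) := fun n y => by simp [hE, hd]
  let K : ℕ → (X →₀ R) →ₗ[R] (X →₀ R) := fun k =>
    Nat.rec (g (S 0)) (fun n f => f + g (S (n+1)) ∘ₗ (LinearMap.id - E n)) k
  have hK0 : K 0 = g (S 0) := rfl
  have hKs : ∀ n y, K (n+1) y = K n y + g (S (n+1)) (y - E n y) := fun n y => rfl
  have hKE : ∀ n y, d (K n y) + K n (d y) = E n y := by
    intro n
    induction n with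
    | zero => intro y; rw [hK0, hE]
    | succ n ih =>
      intro y
      rw [hKs, hKs, hEd, ← map_sub d, map_add]
      have e1 := ih y
      have e2 := hE (n+1) (y - E n y)
      rw [map_sub, hEE] at e2
      rw [add_add_add_comm, e1, ← e2]; abel
  have hKm : ∀ n y, K n y ∈ supported R R (S (n+1) : Set X) := by
    intro n
    induction n with
    | zero => intro y; rw [hK0, hS]; exact h3 _ _
    | succ n ih =>
      intro y
      rw [hKs]
      refine add_mem (supported_mono (by exact_mod_cast mono (Nat.le_succ _)) (ih y)) ?_
      rw [hS (n+1)]; exact h3 _ _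
  have hKst : ∀ k, ∀ y ∈ supported R R (S k : Set X), ∀ n, k ≤ n → K n y = K k y := by
    intro k y hy n hn
    induction n, hn using Nat.le_induction with
    | base => rfl
    | succ n hn ih =>
      rw [hKs, ih, hE1 n y (supported_mono (by exact_mod_cast mono hn) hy)]; simp
  let Z : Set X := {s | ∃ n, s ∈ S n}
  let N : X → ℕ := fun s => if h : ∃ n, s ∈ S n then Nat.find h else 0
  have hN : ∀ s k, s ∈ S k → s ∈ S (N s) ∧ N s ≤ k := by
    intro s k hk
    have h : ∃ n, s ∈ S n := ⟨k, hk⟩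
    simp only [N, dif_pos h]
    exact ⟨Nat.find_spec h, Nat.find_min' h hk⟩
  let H : (X →₀ R) →ₗ[R] (X →₀ R) := linearCombination R fun s => K (N s) (single s 1)
  have hH : ∀ k, ∀ y ∈ supported R R (S k : Set X), H y = K k y := by
    intro k
    apply supp_eq
    intro s hs
    obtain ⟨a, b⟩ := hN s k hs
    simp only [H, linearCombination_single, one_smul]
    exact (hKst _ _ (single_mem_supported R 1 a) _ b).symm
  have hSZ : ∀ k, (S k : Set X) ⊆ Z := fun k s hs => ⟨k, hs⟩
  refine ⟨Z, H, ⟨0, by simp [S]⟩, good_of_basis ?_⟩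
  rintro s ⟨k, hk⟩
  have hsk : single s (1:R) ∈ supported R R (S k : Set X) := single_mem_supported R 1 hk
  have hds : d (single s (1:R)) ∈ supported R R (S (k+1) : Set X) := by
    rw [hS]; exact h2 _ _ hsk
  have hsk' : single s (1:R) ∈ supported R R (S (k+1) : Set X) :=
    supported_mono (by exact_mod_cast mono (Nat.le_succ _)) hsk
  refine ⟨supported_mono (hSZ _) hds, ?_, ?_⟩
  · rw [hH _ _ hsk]; exact supported_mono (hSZ _) (hKm _ _)
  · rw [hH _ _ hsk', hH _ _ hds]
    exact (hKE (k+1) _).trans (hE1 (k+1) _ hsk')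

lemma extend {d : (X →₀ R) →ₗ[R] (X →₀ R)} (hd : ∀ y, d (d y) = 0) (L : Loc d)
    {Y : Set X} {h : (X →₀ R) →ₗ[R] (X →₀ R)} (hY : Good d Y h) (x : X) (hx : x ∉ Y) :
    ∃ (Y' : Set X) (h' : (X →₀ R) →ₗ[R] (X →₀ R)), Good d Y' h' ∧ Y ⊆ Y' ∧ x ∈ Y' ∧
      ∀ y ∈ supported R R Y, h' y = h y := by
  classical
  let V := {x // x ∉ Y}
  let i : (V →₀ R) →ₗ[R] (X →₀ R) := lmapDomain R R Subtype.val
  let r : (X →₀ R) →ₗ[R] (V →₀ R) := lcomapDomain Subtype.val Subtype.val_injective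
  have ri : ∀ z, r (i z) = z := fun z => by
    ext v
    simp [r, i, lcomapDomain, mapDomain_apply Subtype.val_injective]
  have r0 : ∀ y ∈ supported R R Y, r y = 0 := fun y hy => by
    ext v
    rw [mem_supported'] at hy
    simpa [r, lcomapDomain] using hy v v.2
  have ir : ∀ y, y - i (r y) ∈ supported R R Y := fun y => by
    rw [mem_supported']
    intro a ha
    have : (i (r y)) a = y a := by
      have := mapDomain_apply (M := R) Subtype.val_injective (r y) (⟨a, ha⟩ : V)
      simpa [i, r, lcomapDomain] using this
    simp [this]
  let ht := h ∘ₗ fl R Y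
  have htY : ∀ y ∈ supported R R Y, ht y = h y := fun y hy => by
    simp only [ht, LinearMap.comp_apply, fl_eq hy]
  have htm : ∀ y, ht y ∈ supported R R Y := fun y => (hY _ (fl_mem Y y)).2.1
  let e := d ∘ₗ ht + ht ∘ₗ d
  have he : ∀ y, e y = d (ht y) + ht (d y) := fun y => rfl
  have hem : ∀ y, e y ∈ supported R R Y := fun y => add_mem (hY _ (htm y)).1 (htm _)
  have heY : ∀ y ∈ supported R R Y, e y = y := fun y hy => by
    rw [he, htY y hy, htY _ (hY y hy).1]; exact (hY y hy).2.2
  have hed : ∀ y, e (d y) = d (e y) := fun y => by simp [he, hd]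
  let c := r ∘ₗ d ∘ₗ i
  have cr : ∀ y, c (r y) = r (d y) := fun y => by
    have := r0 _ (hY _ (ir y)).1
    rw [map_sub, map_sub, sub_eq_zero] at this
    exact this.symm
  have hc : ∀ z, c (c z) = 0 := fun z => by
    have : c z = r (d (i z)) := rfl
    rw [this, cr, hd, map_zero]
  let j : (V →₀ R) →ₗ[R] (X →₀ R) := i - e ∘ₗ i
  have hj : ∀ z, j z = i z - e (i z) := fun z => rfl
  have jr : ∀ y, j (r y) = y - e y := fun y => by
    have := heY _ (ir y)
    rw [map_sub] at this
    rw [hj]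
    have h2 : e y = y - i (r y) + e (i (r y)) := by rw [← this]; abel
    rw [h2]; abel
  have rj : ∀ z, r (j z) = z := fun z => by
    rw [hj, map_sub, ri, r0 _ (hem _), sub_zero]
  have jc : ∀ z, j (c z) = d (j z) := fun z => by
    have h1 := cr (i z)
    rw [ri] at h1
    rw [h1, jr, hed, ← map_sub]; rfl
  have Lc : Loc c := by
    intro A
    obtain ⟨k, hk⟩ := L (A.image j)
    refine ⟨r ∘ₗ k ∘ₗ j, fun y hy => ?_⟩
    simp only [LinearMap.comp_apply]
    rw [cr, jc, ← map_add, hk _ (Finset.mem_image_of_mem _ hy), rj]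
  obtain ⟨Z, k, hxZ, hZ⟩ := seq hc Lc ⟨x, hx⟩
  let Y' : Set X := Y ∪ Subtype.val '' Z
  have hYY : supported R R Y ≤ supported R R Y' := supported_mono Set.subset_union_left
  have iZ : ∀ z ∈ supported R R Z, i z ∈ supported R R Y' := by
    apply supp_mem
    intro s hs
    simp only [i, lmapDomain_apply, mapDomain_single]
    exact single_mem_supported R 1 (Or.inr ⟨s, hs, rfl⟩)
  have jZ : ∀ z ∈ supported R R Z, j z ∈ supported R R Y' := fun z hz =>
    sub_mem (iZ z hz) (hYY (hem _))
  have rY : ∀ y ∈ supported R R Y', r y ∈ supported R R Z := by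
    intro y hy
    rw [mem_supported'] at hy ⊢
    intro v hv
    have := hy v (by
      rintro (h | ⟨w, hw, hwv⟩)
      · exact v.2 h
      · exact hv (Subtype.ext hwv ▸ hw))
    simpa [r, lcomapDomain] using this
  have dec : ∀ y, y = e y + j (r y) := fun y => by rw [jr]; abel
  let H := ht ∘ₗ e + j ∘ₗ k ∘ₗ r
  have hH : ∀ y, H y = ht (e y) + j (k (r y)) := fun y => rfl
  refine ⟨Y', H, ?_, Set.subset_union_left, Or.inr ⟨⟨x, hx⟩, hxZ, rfl⟩, ?_⟩
  · intro y hy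
    obtain ⟨z1, z2, z3⟩ := hZ _ (rY y hy)
    refine ⟨?_, ?_, ?_⟩
    · rw [dec y, map_add, ← jc]
      exact add_mem (hYY (hY _ (hem y)).1) (jZ _ z1)
    · exact add_mem (hYY (htm _)) (jZ _ z2)
    · rw [hH, hH, hed, map_add, ← jc, ← cr, add_add_add_comm, ← he, heY _ (hem y), ← map_add, z3,
        ← dec]
  · intro y hy
    rw [hH, r0 y hy, heY y hy, htY y hy]; simp

lemma contract {d : (X →₀ R) →ₗ[R] (X →₀ R)} (hd : ∀ y, d (d y) = 0) (L : Loc d) :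
    ∃ h : (X →₀ R) →ₗ[R] (X →₀ R), ∀ y, d (h y) + h (d y) = y := by
  classical
  let T := {a : Set X × ((X →₀ R) →ₗ[R] (X →₀ R)) // Good d a.1 a.2}
  let rel : T → T → Prop := fun a b => a.1.1 ⊆ b.1.1 ∧ ∀ y ∈ supported R R a.1.1, b.1.2 y = a.1.2 y
  obtain ⟨m, hm⟩ := exists_maximal_of_chains_bounded (r := rel) (by
    intro C hC
    let Y : Set X := {s | ∃ a ∈ C, s ∈ a.1.1}
    let H : (X →₀ R) →ₗ[R] (X →₀ R) := linearCombination R fun s =>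
      if h : ∃ a ∈ C, s ∈ a.1.1 then h.choose.1.2 (single s 1) else 0
    have hHa : ∀ a ∈ C, ∀ y ∈ supported R R a.1.1, H y = a.1.2 y := by
      intro a ha
      apply supp_eq
      intro s hs
      have h : ∃ a ∈ C, s ∈ a.1.1 := ⟨a, ha, hs⟩
      simp only [H, linearCombination_single, one_smul, dif_pos h]
      obtain ⟨h1, h2⟩ := h.choose_spec
      by_cases heq : h.choose = a
      · rw [heq]
      · rcases hC h1 ha heq with h3 | h3
        · exact (h3.2 _ (single_mem_supported R 1 h2)).symm
        · exact (h3.2 _ (single_mem_supported R 1 hs))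
    have hYm : ∀ a ∈ C, a.1.1 ⊆ Y := fun a ha s hs => ⟨a, ha, hs⟩
    refine ⟨⟨(Y, H), good_of_basis ?_⟩, fun a ha => ⟨hYm a ha, hHa a ha⟩⟩
    rintro s ⟨a, ha, hs⟩
    have hs' : single s (1:R) ∈ supported R R a.1.1 := single_mem_supported R 1 hs
    obtain ⟨z1, z2, z3⟩ := a.2 _ hs'
    have := hHa a ha
    simp only
    rw [this _ hs', this _ z1]
    exact ⟨supported_mono (hYm a ha) z1, supported_mono (hYm a ha) z2, z3⟩)
    (by
      intro a b c hab hbc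
      exact ⟨hab.1.trans hbc.1, fun y hy => (hbc.2 y (supported_mono hab.1 hy)).trans (hab.2 y hy)⟩)
  have hu : ∀ x, x ∈ m.1.1 := by
    intro x
    by_contra hx
    obtain ⟨Y', h', hg, hs, hxY, hh⟩ := extend hd L m.2 x hx
    exact hx ((hm ⟨(Y', h'), hg⟩ ⟨hs, hh⟩).1 hxY)
  refine ⟨m.1.2, fun y => (m.2 y ?_).2.2⟩
  rw [mem_supported]
  exact fun s _ => hu s

lemma psi {F : Type*} [AddCommGroup F] [Module R F] [Module.Flat R F]
    (i : F →ₗ[R] (X →₀ R)) (p : (X →₀ R) →ₗ[R] F) (hp : Function.Surjective p)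
    (hexact : LinearMap.range i = LinearMap.ker p) (A : Finset (X →₀ R)) :
    ∃ ψ : (X →₀ R) →ₗ[R] (X →₀ R), ∀ y ∈ A, i (p (ψ (i (p y)))) = i (p y) := by
  classical
  have pi0 : ∀ f, p (i f) = 0 := fun f => by
    rw [← LinearMap.mem_ker, ← hexact]; exact ⟨f, rfl⟩
  obtain ⟨T, hT⟩ := exists_fin (A.image fun y => i (p y))
  let N := supported R R (T : Set X)
  have : Module.Free R N := Module.Free.of_equiv (supportedEquivFinsupp (M := R) (R := R) (T : Set X)).symm
  have : Module.Finite R N := Module.Finite.equiv (supportedEquivFinsupp (M := R) (R := R) (T : Set X)).symm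
  let r : (X →₀ R) →ₗ[R] N := (fl R (T : Set X)).codRestrict N (fl_mem _)
  have hr : ∀ y (hy : y ∈ N), ((r y : N) : X →₀ R) = y := fun y hy => fl_eq hy
  let f : (A →₀ R) →ₗ[R] N := linearCombination R fun a : A => r (i (p a))
  have hA : ∀ y ∈ A, i (p y) ∈ N := fun y hy => hT _ (Finset.mem_image_of_mem _ hy)
  obtain ⟨k, a, y, h1, h2⟩ := Module.Flat.exists_factorization_of_comp_eq_zero_of_free
    (M := F) (K := A →₀ R) (N := N) (f := f) (x := p ∘ₗ N.subtype) (by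
      ext a
      simp [f, hr _ (hA a a.2), pi0])
  obtain ⟨yt, hyt⟩ := Module.projective_lifting_property p y hp
  let φ : N →ₗ[R] (X →₀ R) := N.subtype - yt ∘ₗ a
  have hφ : ∀ n, φ n ∈ LinearMap.range (i ∘ₗ p) := by
    intro n
    have : p (φ n) = 0 := by
      have e1 := LinearMap.congr_fun h1 n
      have e2 := LinearMap.congr_fun hyt (a n)
      simp only [LinearMap.comp_apply, Submodule.subtype_apply] at e1 e2
      simp [φ, e1, e2]
    rw [← LinearMap.mem_ker, ← hexact] at this
    obtain ⟨g, hg⟩ := this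
    obtain ⟨w, rfl⟩ := hp g
    exact ⟨w, hg⟩
  obtain ⟨ψ, hψ⟩ := Module.projective_lifting_property (i ∘ₗ p).rangeRestrict
    (φ.codRestrict _ hφ) (LinearMap.surjective_rangeRestrict _)
  refine ⟨ψ ∘ₗ r, fun z hz => ?_⟩
  have e1 := congrArg Subtype.val (LinearMap.congr_fun hψ (r (i (p z))))
  have e2 : a (r (i (p z))) = 0 := by
    have := LinearMap.congr_fun h2 (single ⟨z, hz⟩ 1)
    simpa [f] using this
  have e3 : i (p (ψ (r (i (p z))))) = φ (r (i (p z))) := e1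
  rw [LinearMap.comp_apply, e3]
  simp [φ, e2, hr _ (hA z hz)]

lemma loc {F : Type*} [AddCommGroup F] [Module R F] [Module.Flat R F]
    (i : F →ₗ[R] (X →₀ R)) (p : (X →₀ R) →ₗ[R] F) (hi : Function.Injective i)
    (hp : Function.Surjective p)
    (hexact : LinearMap.range i = LinearMap.ker p) : Loc (i ∘ₗ p) := by
  classical
  intro A
  have pi0 : ∀ f, p (i f) = 0 := fun f => by
    rw [← LinearMap.mem_ker, ← hexact]; exact ⟨f, rfl⟩
  have PS := psi i p hp hexact
  have ex : ∀ y, ∃ v, i (p y) = 0 → i (p v) = y := by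
    intro y
    by_cases h : i (p y) = 0
    · have h2 : p y = 0 := hi (by simpa using h)
      rw [← LinearMap.mem_ker, ← hexact] at h2
      obtain ⟨g, hg⟩ := h2
      obtain ⟨w, rfl⟩ := hp g
      exact ⟨w, fun _ => hg⟩
    · exact ⟨0, fun h' => absurd h' h⟩
  choose v hv using ex
  obtain ⟨q, hq⟩ := PS A
  obtain ⟨s, hs⟩ := PS (A ∪ A.image q)
  obtain ⟨t, ht⟩ := PS (A ∪ A.image q ∪ A.image fun y => v (y - s (i (p y))))
  refine ⟨t ∘ₗ (LinearMap.id - s ∘ₗ i ∘ₗ p) + (s - t) ∘ₗ i ∘ₗ p ∘ₗ q, fun y hy => ?_⟩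
  have a1 := hq y hy
  have a2 := hs y (by simp [hy])
  have a3 := hs (q y) (Finset.mem_union_right _ (Finset.mem_image_of_mem _ hy))
  have a4 := ht (q y) (Finset.mem_union_left _
    (Finset.mem_union_right _ (Finset.mem_image_of_mem _ hy)))
  have a5 := ht (v (y - s (i (p y)))) (Finset.mem_union_right _
    (Finset.mem_image_of_mem (fun y => v (y - s (i (p y)))) hy))
  have a6 := hv (y - s (i (p y))) (by simp [a2])
  rw [a6] at a5
  simp only [LinearMap.comp_apply, LinearMap.add_apply, LinearMap.sub_apply, LinearMap.id_apply,
    map_add, a1, pi0, map_zero, sub_zero, map_sub] at a5 ⊢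
  rw [a3, a4, a5]
  abel

theorem proj_free {F : Type*} [AddCommGroup F] [Module R F] [Module.Flat R F]
    {P : Type*} [AddCommGroup P] [Module R P] [Module.Free R P]
    (i : F →ₗ[R] P) (p : P →ₗ[R] F) (hi : Function.Injective i)
    (hp : Function.Surjective p)
    (hexact : LinearMap.range i = LinearMap.ker p) : Module.Projective R F := by
  let b := (Module.Free.chooseBasis R P).repr
  let i' := b.toLinearMap ∘ₗ i
  let p' := p ∘ₗ b.symm.toLinearMap
  have pi0 : ∀ f, p (i f) = 0 := fun f => by
    rw [← LinearMap.mem_ker, ← hexact]; exact ⟨f, rfl⟩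
  have pi0' : ∀ f, p' (i' f) = 0 := fun f => by simp [p', i', pi0]
  have hi' : Function.Injective i' := b.injective.comp hi
  have hp' : Function.Surjective p' := hp.comp b.symm.surjective
  have hex' : LinearMap.range i' = LinearMap.ker p' := by
    apply le_antisymm
    · rintro _ ⟨f, rfl⟩; exact pi0' f
    · intro y hy
      have : b.symm y ∈ LinearMap.ker p := hy
      rw [← hexact] at this
      obtain ⟨f, hf⟩ := this
      exact ⟨f, by simp [i', hf]⟩
  obtain ⟨h, hh⟩ := contract (d := i' ∘ₗ p') (by intro y; simp [pi0']) (loc i' p' hi' hp' hex')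
  refine Module.Projective.of_split (h ∘ₗ i') p' ?_
  ext f
  have := hh (i' f)
  simp only [LinearMap.comp_apply, pi0', map_zero, add_zero] at this
  exact hi' this

/-- Finitely supported functions into a product. -/
noncomputable def finsuppProd (P K : Type*) [AddCommGroup P] [Module R P] [AddCommGroup K]
    [Module R K] : (ℕ →₀ P × K) ≃ₗ[R] (ℕ →₀ P) × (ℕ →₀ K) :=
  LinearEquiv.ofLinearMap
    ((mapRange.linearMap (LinearMap.fst R P K)).prod (mapRange.linearMap (LinearMap.snd R P K)))
    ((mapRange.linearMap (LinearMap.inl R P K)).coprod (mapRange.linearMap (LinearMap.inr R P K)))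
    (by ext <;> simp) (by ext <;> simp)

theorem swindle (P : Type*) [AddCommGroup P] [Module R P] [Module.Projective R P] :
    Module.Free R (P × (ℕ →₀ (P →₀ R))) := by
  obtain ⟨s, hs⟩ := Module.projective_def'.mp (inferInstance : Module.Projective R P)
  let π : (P →₀ R) →ₗ[R] P := linearCombination R id
  let K := LinearMap.ker π
  have hs' : ∀ x, π (s x) = x := fun x => LinearMap.congr_fun hs x
  let κ : (P →₀ R) →ₗ[R] K := (LinearMap.id - s ∘ₗ π).codRestrict K (by
    intro x; simp [K, hs'])
  let e : (P →₀ R) ≃ₗ[R] P × K := LinearEquiv.ofLinearMap (π.prod κ) (s.coprod K.subtype)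
    (by
      apply LinearMap.ext
      rintro ⟨x, k, hk⟩
      have hk' : π k = 0 := hk
      ext <;> simp [κ, hs', hk'])
    (by
      apply LinearMap.ext
      intro x
      simp [κ])
  let A := (mapRange.linearEquiv (α := ℕ) e).trans (finsuppProd (R := R) P K)
  let sh : (P × (ℕ →₀ P)) ≃ₗ[R] (ℕ →₀ P) :=
    ((LinearEquiv.prodCongr (uniqueLinearEquiv R (M := P) ()).symm (LinearEquiv.refl R _)).trans
      (sumFinsuppLEquivProdFinsupp R).symm).trans
      (Finsupp.domLCongr ((Equiv.sumComm _ _).trans Equiv.natSumPUnitEquivNat))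
  let B : (P × (ℕ →₀ (P →₀ R))) ≃ₗ[R] (ℕ →₀ (P →₀ R)) :=
    (LinearEquiv.prodCongr (LinearEquiv.refl R P) A).trans
    ((LinearEquiv.prodAssoc R P (ℕ →₀ P) (ℕ →₀ K)).symm.trans
    ((LinearEquiv.prodCongr sh (LinearEquiv.refl R _)).trans A.symm))
  exact Module.Free.of_equiv B.symm

theorem flat_prod (F A : Type*) [AddCommGroup F] [Module R F] [AddCommGroup A] [Module R A]
    [Module.Flat R F] [Module.Flat R A] : Module.Flat R (F × A) := by
  rw [Module.Flat.iff_lTensor_injectiveₛ]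
  intro M _ _ N
  have key : ∀ z : TensorProduct R (F × A) N,
      z = (LinearMap.inl R F A).rTensor N ((LinearMap.fst R F A).rTensor N z) +
        (LinearMap.inr R F A).rTensor N ((LinearMap.snd R F A).rTensor N z) := by
    intro z
    rw [← LinearMap.comp_apply, ← LinearMap.comp_apply, ← LinearMap.rTensor_comp,
      ← LinearMap.rTensor_comp, ← LinearMap.add_apply, ← LinearMap.rTensor_add]
    have : LinearMap.inl R F A ∘ₗ LinearMap.fst R F A + LinearMap.inr R F A ∘ₗ LinearMap.snd R F A
        = LinearMap.id := by ext <;> simp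
    rw [this]
    simp
  intro z w h
  have comm : ∀ {G : Type _} [AddCommGroup G] [Module R G] (g : (F × A) →ₗ[R] G)
      (z : TensorProduct R (F × A) N),
      N.subtype.lTensor G (g.rTensor N z) = g.rTensor M (N.subtype.lTensor (F × A) z) := by
    intro G _ _ g z
    rw [← LinearMap.comp_apply, ← LinearMap.comp_apply, LinearMap.lTensor_comp_rTensor,
      LinearMap.rTensor_comp_lTensor]
  have c2 : ∀ (g : (F × A) →ₗ[R] A)
      (z : TensorProduct R (F × A) N),
      N.subtype.lTensor A (g.rTensor N z) = g.rTensor M (N.subtype.lTensor (F × A) z) := by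
    intro g z
    rw [← LinearMap.comp_apply, ← LinearMap.comp_apply, LinearMap.lTensor_comp_rTensor,
      LinearMap.rTensor_comp_lTensor]
  have h1 : (LinearMap.fst R F A).rTensor N z = (LinearMap.fst R F A).rTensor N w :=
    Module.Flat.lTensor_preserves_injective_linearMap (M := F) N.subtype N.injective_subtype
      (by rw [comm, comm, h])
  have h2 : (LinearMap.snd R F A).rTensor N z = (LinearMap.snd R F A).rTensor N w :=
    Module.Flat.lTensor_preserves_injective_linearMap (M := A) N.subtype N.injective_subtype
      (by rw [c2, c2, h])
  rw [key z, key w, h1, h2]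

theorem proj {F : Type*} [AddCommGroup F] [Module R F] [Module.Flat R F]
    {P : Type*} [AddCommGroup P] [Module R P] [Module.Projective R P]
    (i : F →ₗ[R] P) (p : P →ₗ[R] F) (hi : Function.Injective i)
    (hp : Function.Surjective p)
    (hexact : LinearMap.range i = LinearMap.ker p) : Module.Projective R F := by
  have pi0 : ∀ f, p (i f) = 0 := fun f => by
    rw [← LinearMap.mem_ker, ← hexact]; exact ⟨f, rfl⟩
  let A := ℕ →₀ (P →₀ R)
  have : Module.Free R (P × A) := swindle P
  have : Module.Free R ((P × A) × A) := inferInstance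
  have : Module.Flat R (F × A) := flat_prod F A
  let i' : (F × A) →ₗ[R] ((P × A) × A) :=
    (LinearMap.prodMap i LinearMap.id).prod 0
  let p' : ((P × A) × A) →ₗ[R] (F × A) :=
    LinearMap.prodMap (p ∘ₗ LinearMap.fst R P A) LinearMap.id
  have : Module.Projective R (F × A) := by
    refine proj_free (R := R) (F := F × A) (P := (P × A) × A) i' p' ?_ ?_ ?_
    · rintro ⟨f, a⟩ ⟨g, b⟩ h
      have h' := congrArg Prod.fst h
      have h2 : (i' (f, a)).1.2 = (i' (g, b)).1.2 := congrArg Prod.snd h'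
      exact Prod.ext (hi (congrArg Prod.fst h')) h2
    · rintro ⟨f, a⟩
      obtain ⟨x, rfl⟩ := hp f
      exact ⟨((x, 0), a), by simp [p']⟩
    · apply le_antisymm
      · rintro _ ⟨⟨f, a⟩, rfl⟩
        simp [p', i', pi0]
      · rintro ⟨⟨x, a⟩, b⟩ h
        simp only [p', LinearMap.mem_ker, LinearMap.prodMap_apply, LinearMap.comp_apply,
          LinearMap.fst_apply, LinearMap.id_apply, Prod.mk_eq_zero] at h
        have h1 : x ∈ LinearMap.ker p := h.1
        rw [← hexact] at h1
        obtain ⟨f, rfl⟩ := h1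
        exact ⟨(f, a), by simp [i', h.2]⟩
  exact Module.Projective.of_split (LinearMap.inl R F A) (LinearMap.fst R F A) (by ext; simp)

end

end BG

/-- If `F` is flat with a short exact sequence `0 → F → P → F → 0` (`P` projective),
then `F` has projective dimension at most `1`: there is a short exact sequence
`0 → Q₁ → Q₀ → F → 0` with `Q₀, Q₁` projective. -/
theorem stmt_13 (R : Type) [CommRing R]
    (F P : Type) [AddCommGroup F] [Module R F] [AddCommGroup P] [Module R P]
    [Module.Flat R F] [Module.Projective R P]
    (i : F →ₗ[R] P) (p : P →ₗ[R] F)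
    (hi : Function.Injective i) (hp : Function.Surjective p)
    (hexact : LinearMap.range i = LinearMap.ker p) :
    ∃ (Q₁ Q₀ : Type) (_ : AddCommGroup Q₁) (_ : AddCommGroup Q₀)
      (_ : Module R Q₁) (_ : Module R Q₀),
      Module.Projective R Q₁ ∧ Module.Projective R Q₀ ∧
      ∃ (j : Q₁ →ₗ[R] Q₀) (π : Q₀ →ₗ[R] F),
        Function.Injective j ∧ Function.Surjective π ∧
        LinearMap.range j = LinearMap.ker π := by
  exact ⟨F, P, inferInstance, inferInstance, inferInstance, inferInstance,
    BG.proj i p hi hp hexact, inferInstance, i, p, hi, hp, hexact⟩
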